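/- Let q be a prime power, ε ∈ {+1, −1}, and let I be a finite set of positive integers with |I| ≥ 2 such that φ(i) > 2 for every i ∈ I, where φ is Euler's totient function. Then the product over i ∈ I of k_i(εq) is at least C·q^{4|I|} + 1/2, where C = 1/12 if |I| = 2 and C = 1/24 if |I| ≥ 3. -/

import Mathlib

/-- `e(r,a)`: for odd prime `r` coprime to `a`, the multiplicative order of `a` modulo `r`;
for `r = 2` and odd `a`, it is `1` if `a ≡ 1 (mod 4)` and `2` if `a ≡ 3 (mod 4)`. -/
noncomputable def eOrd (r : ℕ) (a : ℤ) : ℕ :=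
  if r = 2 then (if a % 4 = 1 then 1 else 2) else orderOf (a : ZMod r)

/-- `k_i(a)`: the product, over all primitive prime divisors `r` of `a^i - 1`
(i.e. primes `r` with `e(r,a) = i`), of the `r`-part of `a^i - 1`. -/
noncomputable def kPart (i : ℕ) (a : ℤ) : ℕ :=
  ∏ r ∈ (a ^ i - 1).natAbs.primeFactors.filter (fun r => eOrd r a = i),
    r ^ (a ^ i - 1).natAbs.factorization r

open Polynomial in
/-- If a prime `r` divides `Φ_n(a)`, the order of `a` modulo `r` is the prime-to-`r` part of `n`. -/
lemma exists_eq_prime_pow_mul_of_dvd_cyclotomic {n r : ℕ} {a : ℤ} (hn : n ≠ 0) (hr : r.Prime)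
    (h : (r : ℤ) ∣ (cyclotomic n ℤ).eval a) : ∃ k m, n = r ^ k * m ∧ ¬ r ∣ m ∧ m ∣ r - 1 ∧
      IsPrimitiveRoot (a : ZMod r) m := by
  have := Fact.mk hr
  obtain ⟨k, m, hm, rfl⟩ := Nat.exists_eq_pow_mul_and_not_dvd hn r hr.ne_one
  have hm' : NeZero (m : ZMod r) := ⟨by rwa [Ne, ZMod.natCast_eq_zero_iff]⟩
  have hroot : (cyclotomic (r ^ k * m) (ZMod r)).IsRoot (a : ZMod r) := by
    rw [← ZMod.intCast_zmod_eq_zero_iff_dvd, ← eq_intCast (Int.castRingHom _), ← eval_map_apply,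
      map_cyclotomic] at h
    simpa using h
  have hprim : IsPrimitiveRoot (a : ZMod r) m := by
    obtain rfl | hk := Nat.eq_zero_or_pos k
    · rw [pow_zero, one_mul] at hroot
      exact isRoot_cyclotomic_iff.1 hroot
    · exact (isRoot_cyclotomic_prime_pow_mul_iff_of_charP).1 hroot
  refine ⟨k, m, rfl, hm, ?_, hprim⟩
  rw [hprim.eq_orderOf]
  apply ZMod.orderOf_dvd_card_sub_one
  intro h0
  rw [h0] at hprim
  rcases Nat.eq_zero_or_pos m with rfl | hm0
  · simp at hm
  · have := hprim.pow_eq_one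
    rw [zero_pow hm0.ne'] at this
    exact zero_ne_one this

open Polynomial in
lemma prime_eq_of_dvd_of_dvd_cyclotomic {n r s : ℕ} {a : ℤ} (hn : n ≠ 0) (hr : r.Prime)
    (hs : s.Prime) (hrn : r ∣ n) (hsn : s ∣ n) (har : (r : ℤ) ∣ (cyclotomic n ℤ).eval a)
    (has : (s : ℤ) ∣ (cyclotomic n ℤ).eval a) : r = s := by
  have key : ∀ {r s : ℕ}, r.Prime → s.Prime → s ∣ n →
      (r : ℤ) ∣ (cyclotomic n ℤ).eval a → r ≠ s → s < r := by
    intro r s hr hs hsn har hne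
    obtain ⟨k, m, hk, -, hm, -⟩ := exists_eq_prime_pow_mul_of_dvd_cyclotomic hn hr har
    have h1 : s ∣ m := by
      rw [hk] at hsn
      refine (hs.dvd_mul.1 hsn).resolve_left fun h => hne ?_
      exact ((Nat.prime_dvd_prime_iff_eq hs hr).1 (hs.dvd_of_dvd_pow h)).symm
    have := Nat.le_of_dvd (by have := hr.two_le; omega) (h1.trans hm)
    have := hr.two_le
    omega
  by_contra hne
  exact lt_asymm (key hr hs hsn har hne) (key hs hr hrn has (Ne.symm hne))

open Polynomial in
lemma not_prime_sq_dvd_cyclotomic {n r : ℕ} {a : ℤ} (hn : 3 ≤ n) (ha : 2 ≤ a.natAbs)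
    (hr : r.Prime) (hrn : r ∣ n) : ¬ (r : ℤ) ^ 2 ∣ (cyclotomic n ℤ).eval a := by
  intro hsq
  have := Fact.mk hr
  have hdvd : (r : ℤ) ∣ (cyclotomic n ℤ).eval a := (dvd_pow_self _ two_ne_zero).trans hsq
  have hcyc : (cyclotomic n ℤ).eval a ∣ a ^ n - 1 := by
    simpa using eval_dvd (x := a) (cyclotomic.dvd_X_pow_sub_one n ℤ)
  have hra : ¬ (r : ℤ) ∣ a := fun h => by
    have h1 := dvd_sub (h.trans (dvd_pow_self a (by omega : n ≠ 0))) (hdvd.trans hcyc)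
    rw [sub_sub_cancel] at h1
    exact hr.one_lt.ne' (by exact_mod_cast Int.natAbs_dvd_natAbs.2 h1 |> Nat.dvd_one.1)
  obtain ⟨t, rfl⟩ := hrn
  have ht : t ≠ 0 := by rintro rfl; omega
  have hprop : t ∈ (r * t).properDivisors := Nat.mem_properDivisors.2
    ⟨dvd_mul_left _ _, by nlinarith [hr.two_le, Nat.pos_of_ne_zero ht]⟩
  have hmul : (a ^ t - 1) * (cyclotomic (r * t) ℤ).eval a ∣ (a ^ t) ^ r - 1 := by
    have := eval_dvd (x := a) (X_pow_sub_one_mul_cyclotomic_dvd_X_pow_sub_one_of_dvd ℤ hprop)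
    simpa [← pow_mul, mul_comm t r] using this
  have hb : (r : ℤ) ∣ a ^ t - 1 := by
    have h1 := hdvd.trans hcyc
    rw [← ZMod.intCast_zmod_eq_zero_iff_dvd] at h1 ⊢
    push_cast at h1 ⊢
    rwa [mul_comm, pow_mul, ZMod.pow_card] at h1
  have hne : a ^ t - 1 ≠ 0 := fun h => by
    have h1 : a.natAbs ^ t = 1 := by rw [← Int.natAbs_pow, sub_eq_zero.1 h]; rfl
    have := Nat.one_lt_pow ht (by omega : 1 < a.natAbs)
    omega
  have hsq' : (a ^ t - 1) * (r : ℤ) ^ 2 ∣ (a ^ t) ^ r - 1 := (mul_dvd_mul_left _ hsq).trans hmul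
  obtain rfl | hodd := hr.eq_two_or_odd'
  · obtain ⟨k, m, hk, hm2, hm1, -⟩ :=
      exists_eq_prime_pow_mul_of_dvd_cyclotomic (by omega) hr hdvd
    obtain rfl : m = 1 := by simpa using hm1
    have h4 : (4 : ℤ) ∣ a ^ t + 1 := by
      have : (a ^ t) ^ 2 - 1 = (a ^ t - 1) * (a ^ t + 1) := by ring
      rw [this] at hsq'
      simpa using (mul_dvd_mul_iff_left hne).1 hsq'
    obtain _ | _ | k := k
    · omega
    · omega
    · have ht2 : t = 2 * 2 ^ k := by rw [pow_succ, pow_succ] at hk; omega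
      have ho : Odd (a ^ 2 ^ k) := by
        rw [Int.odd_pow]; left; rwa [← Int.not_even_iff_odd, even_iff_two_dvd]
      have := Int.sq_mod_four_eq_one_of_odd ho
      rw [ht2, mul_comm, pow_mul] at h4
      omega
  · have hrb : ¬ (r : ℤ) ∣ a ^ t := fun h => hra ((Nat.prime_iff_prime_int.1 hr).dvd_of_dvd_pow h)
    have hlte := Int.emultiplicity_pow_sub_pow hr hodd (x := a ^ t) (y := 1) hb hrb r
    have hle := emultiplicity_le_emultiplicity_of_dvd_right (a := (r : ℤ)) hsq'
    rw [one_pow] at hlte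
    rw [hlte, emultiplicity_mul (Nat.prime_iff_prime_int.1 hr)] at hle
    have hfin : FiniteMultiplicity (r : ℤ) (a ^ t - 1) :=
      Int.finiteMultiplicity_iff.2 ⟨by simpa using hr.ne_one, hne⟩
    rw [hfin.emultiplicity_eq_multiplicity, emultiplicity_pow_self_of_prime
      (Nat.prime_iff_prime_int.1 hr), (Nat.finiteMultiplicity_iff.2
        ⟨hr.ne_one, hr.pos⟩).emultiplicity_eq_multiplicity, multiplicity_self] at hle
    norm_cast at hle
    omega

lemma kPart_pos (i : ℕ) (a : ℤ) : 0 < kPart i a :=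
  Finset.prod_pos fun _ hr =>
    pow_pos (Nat.prime_of_mem_primeFactors (Finset.mem_filter.1 hr).1).pos _

open Polynomial in
lemma exists_cyclotomic_dvd_mul_kPart {n : ℕ} {a : ℤ} (hn : 3 ≤ n) (ha : 2 ≤ a.natAbs) :
    ∃ c : ℕ, (c = 1 ∨ c.Prime ∧ c ∣ n ∧ (c : ℤ) ∣ (cyclotomic n ℤ).eval a) ∧
      ((cyclotomic n ℤ).eval a).natAbs ∣ c * kPart n a := by
  have hcyc : (cyclotomic n ℤ).eval a ∣ a ^ n - 1 := by
    simpa using eval_dvd (x := a) (cyclotomic.dvd_X_pow_sub_one n ℤ)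
  have hM : (a ^ n - 1).natAbs ≠ 0 := fun h => by
    have h1 : a.natAbs ^ n = 1 := by
      rw [← Int.natAbs_pow, sub_eq_zero.1 (Int.natAbs_eq_zero.1 h)]; rfl
    have := Nat.one_lt_pow (by omega : n ≠ 0) (by omega : 1 < a.natAbs)
    omega
  have key : ∀ p j : ℕ, p.Prime → ¬ p ∣ n → p ^ j ∣ ((cyclotomic n ℤ).eval a).natAbs →
      p ^ j ∣ kPart n a := by
    intro p j hp hpn hpj
    obtain rfl | hj := Nat.eq_zero_or_pos j
    · simp
    have hpd : (p : ℤ) ∣ (cyclotomic n ℤ).eval a :=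
      Int.natCast_dvd.2 ((dvd_pow_self p hj.ne').trans hpj)
    have hpM : p ^ j ∣ (a ^ n - 1).natAbs := hpj.trans (Int.natAbs_dvd_natAbs.2 hcyc)
    obtain ⟨k, m, hk, hm, hm1, hprim⟩ :=
      exists_eq_prime_pow_mul_of_dvd_cyclotomic (by omega) hp hpd
    obtain rfl : k = 0 := by
      by_contra h0
      exact hpn (hk ▸ (dvd_pow_self p h0).mul_right m)
    obtain rfl : n = m := by simpa using hk
    have hp2 : p ≠ 2 := by
      rintro rfl
      have := Nat.le_of_dvd (by norm_num) hm1
      omega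
    have hmem : p ∈ (a ^ n - 1).natAbs.primeFactors.filter (fun r => eOrd r a = n) := by
      rw [Finset.mem_filter, Nat.mem_primeFactors]
      refine ⟨⟨hp, (dvd_pow_self p hj.ne').trans hpM, hM⟩, ?_⟩
      rw [eOrd, if_neg hp2, ← hprim.eq_orderOf]
    exact (pow_dvd_pow p ((hp.pow_dvd_iff_le_factorization hM).1 hpM)).trans
      (Finset.dvd_prod_of_mem (fun r => r ^ (a ^ n - 1).natAbs.factorization r) hmem)
  by_cases hex : ∃ c : ℕ, c.Prime ∧ c ∣ n ∧ (c : ℤ) ∣ (cyclotomic n ℤ).eval a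
  · obtain ⟨c, hc, hcn, hca⟩ := hex
    refine ⟨c, Or.inr ⟨hc, hcn, hca⟩, (Nat.dvd_iff_prime_pow_dvd_dvd _ _).2 fun p j hp hpj => ?_⟩
    by_cases hpn : p ∣ n
    · obtain _ | _ | j := j
      · simp
      · rw [zero_add, pow_one] at hpj ⊢
        rw [prime_eq_of_dvd_of_dvd_cyclotomic (by omega) hp hc hpn hcn (Int.natCast_dvd.2 hpj) hca]
        exact dvd_mul_right _ _
      · refine absurd ?_ (not_prime_sq_dvd_cyclotomic hn ha hp hpn)
        have := (pow_dvd_pow p (by omega : 2 ≤ j + 1 + 1)).trans hpj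
        exact_mod_cast Int.natCast_dvd.2 this
    · exact (key p j hp hpn hpj).mul_left _
  · refine ⟨1, Or.inl rfl, (Nat.dvd_iff_prime_pow_dvd_dvd _ _).2 fun p j hp hpj => ?_⟩
    rw [one_mul]
    by_cases hpn : p ∣ n
    · obtain _ | j := j
      · simp
      · exact absurd ⟨p, hp, hpn, Int.natCast_dvd.2 ((dvd_pow_self p (by omega)).trans hpj)⟩ hex
    · exact key p j hp hpn hpj

lemma quarter_add_le_prod_one_sub_half_pow (n : ℕ) :
    1 / 4 + (1 / 2 : ℚ) ^ (n + 1) / 2 ≤ ∏ d ∈ Finset.range (n + 1), (1 - (1 / 2 : ℚ) ^ (d + 1)) := by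
  induction n with
  | zero => norm_num
  | succ n ih =>
    rw [Finset.prod_range_succ]
    have hy : (0 : ℚ) < (1 / 2) ^ (n + 1) := by positivity
    have hy' : (1 / 2 : ℚ) ^ (n + 1) ≤ 1 / 2 := by
      rw [pow_succ]
      linarith [pow_le_one₀ (by norm_num : (0 : ℚ) ≤ 1 / 2) (by norm_num : (1 / 2 : ℚ) ≤ 1) (n := n)]
    rw [pow_succ _ (n + 1)]
    generalize (1 / 2 : ℚ) ^ (n + 1) = y at *
    nlinarith [mul_le_mul_of_nonneg_right ih (by linarith : 0 ≤ 1 - y * (1 / 2))]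

lemma quarter_le_prod_divisors_one_sub_pow {x : ℚ} (hx0 : 0 ≤ x) (hx : x ≤ 1 / 2) {n : ℕ}
    (hn : 0 < n) : 1 / 4 ≤ ∏ d ∈ n.divisors, (1 - x ^ d) := by
  obtain ⟨m, rfl⟩ : ∃ m, n = m + 1 := ⟨n - 1, by omega⟩
  have hle : ∀ d : ℕ, x ^ d ≤ 1 := fun d => pow_le_one₀ hx0 (by linarith)
  calc (1 / 4 : ℚ) ≤ 1 / 4 + (1 / 2 : ℚ) ^ (m + 1) / 2 := by
        have : (0 : ℚ) < (1 / 2) ^ (m + 1) := by positivity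
        linarith
    _ ≤ ∏ d ∈ Finset.range (m + 1), (1 - (1 / 2 : ℚ) ^ (d + 1)) :=
        quarter_add_le_prod_one_sub_half_pow m
    _ ≤ ∏ d ∈ Finset.range (m + 1), (1 - x ^ (d + 1)) := by
        refine Finset.prod_le_prod (fun d _ => ?_) fun d _ => ?_
        · exact sub_nonneg.2 (pow_le_one₀ (by norm_num) (by norm_num))
        · gcongr
    _ = ∏ d ∈ Finset.Ico 1 (m + 1 + 1), (1 - x ^ d) := by
        rw [Finset.prod_Ico_eq_prod_range]
        simp [add_comm]
    _ ≤ ∏ d ∈ (m + 1).divisors, (1 - x ^ d) := by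
        refine Finset.prod_le_prod_of_subset_of_le_one ?_ ?_ ?_
        · exact Finset.filter_subset _ _
        · exact fun d _ => sub_nonneg.2 (hle d)
        · exact fun d _ _ => by linarith [pow_nonneg hx0 d]

lemma one_sub_le_zpow_moebius {x y : ℚ} (hx : x < 1) (hy0 : 1 - x ≤ y)
    (hy1 : y ≤ 1 + x) (n : ℕ) : 1 - x ≤ y ^ ArithmeticFunction.moebius n := by
  rcases ArithmeticFunction.moebius_eq_or n with h | h | h <;> rw [h]
  · simp; linarith
  · rwa [zpow_one]
  · rw [zpow_neg_one, le_inv_comm₀ (by linarith) (by linarith)]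
    refine hy1.trans ?_
    rw [le_inv_comm₀ (by linarith) (by linarith), ← one_div, le_div_iff₀ (by linarith)]
    nlinarith

open Polynomial in
lemma pow_totient_le_four_mul_cyclotomic {n : ℕ} {a : ℤ} (hn : 0 < n) (ha : 2 ≤ a.natAbs) :
    a.natAbs ^ n.totient ≤ 4 * ((cyclotomic n ℤ).eval a).natAbs := by
  have hq : (2 : ℚ) ≤ |(a : ℚ)| := by
    rw [← Int.cast_abs, Int.abs_eq_natAbs]; exact_mod_cast ha
  have hq0 : (0 : ℚ) < |(a : ℚ)| := by linarith
  set x : ℚ := |(a : ℚ)|⁻¹ with hx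
  have hx0 : 0 < x := inv_pos.2 hq0
  have hxle : x ≤ 1 / 2 := by rw [hx, one_div]; exact inv_anti₀ (by norm_num) hq
  let f : ℕ → ℚ := fun m => |(((cyclotomic m ℤ).eval a : ℤ) : ℚ)| * x ^ m.totient
  let g : ℕ → ℚ := fun m => |((a ^ m - 1 : ℤ) : ℚ)| * x ^ m
  have hfg : ∀ m > 0, ∏ i ∈ m.divisors, f i = g m := by
    intro m hm
    have h := congrArg (eval a) (prod_cyclotomic_eq_X_pow_sub_one hm ℤ)
    rw [eval_prod, eval_sub, eval_pow, eval_X, eval_one] at h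
    simp only [f, g]
    rw [Finset.prod_mul_distrib, Finset.prod_pow_eq_pow_sum, Nat.sum_totient, ← h,
      Int.cast_prod, Finset.abs_prod]
  have hxm : ∀ m > 0, x ^ m < 1 := fun m hm => pow_lt_one₀ hx0.le (by linarith) hm.ne'
  have hax : ∀ m, |(a : ℚ) ^ m| * x ^ m = 1 := fun m => by
    rw [abs_pow, ← mul_pow, hx, mul_inv_cancel₀ hq0.ne', one_pow]
  have hg1 : ∀ m, 1 - x ^ m ≤ g m := fun m => by
    have := abs_sub_abs_le_abs_sub ((a : ℚ) ^ m) 1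
    have h2 := mul_le_mul_of_nonneg_right this (pow_nonneg hx0.le m)
    rw [sub_mul, hax, abs_one, one_mul] at h2
    simpa [g] using h2
  have hg2 : ∀ m, g m ≤ 1 + x ^ m := fun m => by
    have := abs_sub ((a : ℚ) ^ m) 1
    have h2 := mul_le_mul_of_nonneg_right this (pow_nonneg hx0.le m)
    rw [add_mul, hax, abs_one, one_mul] at h2
    simpa [g] using h2
  have hg0 : ∀ m > 0, g m ≠ 0 := fun m hm => by
    have := hg1 m; have := hxm m hm; exact ne_of_gt (by linarith)
  have hf0 : ∀ m > 0, f m ≠ 0 := fun m hm h => by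
    refine hg0 m hm ?_
    rw [← hfg m hm]
    exact Finset.prod_eq_zero (Nat.mem_divisors_self m hm.ne') h
  have hinv := (ArithmeticFunction.prod_eq_iff_prod_pow_moebius_eq_of_nonzero hf0 hg0).1 hfg n hn
  have hle : 1 / 4 ≤ f n := by
    rw [← hinv]
    refine (quarter_le_prod_divisors_one_sub_pow hx0.le hxle hn).trans ?_
    rw [← Nat.prod_divisorsAntidiagonal' fun _ d => 1 - x ^ d]
    refine Finset.prod_le_prod (fun y hy => ?_) fun y hy => ?_
    all_goals
      have hpos : 0 < y.2 := Nat.pos_of_ne_zero (Nat.ne_zero_of_mem_divisorsAntidiagonal hy).2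
      have := hxm _ hpos
    · exact sub_nonneg.2 this.le
    · exact one_sub_le_zpow_moebius this (hg1 _) (hg2 _) _
  have hfin := mul_le_mul_of_nonneg_right hle (pow_nonneg hq0.le n.totient)
  simp only [f] at hfin
  rw [mul_assoc, hx, ← mul_pow, inv_mul_cancel₀ hq0.ne', one_pow, mul_one] at hfin
  have : ((a.natAbs : ℚ)) ^ n.totient ≤ 4 * ((cyclotomic n ℤ).eval a).natAbs := by
    rw [Nat.cast_natAbs, Nat.cast_natAbs, Int.cast_abs, Int.cast_abs]
    linarith
  exact_mod_cast this

lemma dvd_of_totient_lt_ten {n : ℕ} (h0 : 0 < n) (h : n.totient < 10) : n ∣ 5040 := by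
  rw [Nat.dvd_iff_prime_pow_dvd_dvd]
  intro p k hp hpk
  obtain rfl | hk := Nat.eq_zero_or_pos k
  · simp
  have h1 := Nat.le_of_dvd (Nat.totient_pos.2 h0) (Nat.totient_dvd_of_dvd hpk)
  rw [Nat.totient_prime_pow hp hk] at h1
  have hp2 := hp.two_le
  have hpk1 : 0 < p ^ (k - 1) := by positivity
  have hp10 : p ≤ 10 := by
    have : 1 * (p - 1) ≤ p ^ (k - 1) * (p - 1) := Nat.mul_le_mul_right _ hpk1
    omega
  have hk4 : k ≤ 4 := by
    by_contra hk4
    have h2 : 2 ^ 4 ≤ p ^ (k - 1) :=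
      (Nat.pow_le_pow_left hp2 4).trans (Nat.pow_le_pow_right (by omega) (by omega))
    have : p ^ (k - 1) * 1 ≤ p ^ (k - 1) * (p - 1) := Nat.mul_le_mul_left _ (by omega)
    omega
  interval_cases p <;> first | (exfalso; revert hp; decide) | skip
  all_goals interval_cases k <;> first | decide | omega

lemma totient_small_cases {n : ℕ} (h0 : 0 < n) (h2 : 2 < n.totient) (h : n.totient < 10) :
    n ∈ ({5, 8, 10, 12} : Finset ℕ) ∨ n.totient = 6 ∧ n ∈ ({7, 9, 14, 18} : Finset ℕ) ∨
      n.totient = 8 ∧ n ∈ ({15, 16, 20, 24, 30} : Finset ℕ) := by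
  open scoped Pointwise in
  have key : ∀ n ∈ Nat.divisors 5040, 2 < n.totient → n.totient < 10 →
    n ∈ ({5, 8, 10, 12} : Finset ℕ) ∨ n.totient = 6 ∧ n ∈ ({7, 9, 14, 18} : Finset ℕ) ∨
      n.totient = 8 ∧ n ∈ ({15, 16, 20, 24, 30} : Finset ℕ) := by
    have hd : Nat.divisors 5040 = (Nat.divisors 144 * Nat.divisors 35) := by
      rw [← Nat.divisors_mul]
    rw [hd, show Nat.divisors 144 = {1,2,3,4,6,8,9,12,16,18,24,36,48,72,144} by decide +kernel,
      show Nat.divisors 35 = {1,5,7,35} by decide +kernel]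
    decide +kernel
  exact key n (Nat.mem_divisors.2 ⟨dvd_of_totient_lt_ten h0 h, by norm_num⟩) h2 h

open Polynomial in
lemma eval_cyclotomic_pow_of_not_dvd {p n : ℕ} (hp : p.Prime) (h : ¬ p ∣ n) (a : ℤ) :
    (cyclotomic n ℤ).eval (a ^ p) = (cyclotomic (n * p) ℤ).eval a * (cyclotomic n ℤ).eval a := by
  rw [← expand_eval, cyclotomic_expand_eq_cyclotomic_mul hp h, eval_mul]

open Polynomial in
lemma eval_cyclotomic_pow_of_dvd {p n : ℕ} (hp : p.Prime) (h : p ∣ n) (a : ℤ) :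
    (cyclotomic n ℤ).eval (a ^ p) = (cyclotomic (n * p) ℤ).eval a := by
  rw [← expand_eval, cyclotomic_expand_eq_cyclotomic hp h]

open Polynomial in
lemma eval_cyclotomic_five (a : ℤ) :
    (cyclotomic 5 ℤ).eval a = a ^ 4 + a ^ 3 + a ^ 2 + a + 1 := by
  have := Fact.mk Nat.prime_five
  simp [cyclotomic_prime, Finset.sum_range_succ]; ring

open Polynomial in
lemma eval_cyclotomic_seven (a : ℤ) :
    (cyclotomic 7 ℤ).eval a = a ^ 6 + a ^ 5 + a ^ 4 + a ^ 3 + a ^ 2 + a + 1 := by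
  have := Fact.mk Nat.prime_seven
  simp [cyclotomic_prime, Finset.sum_range_succ]; ring

open Polynomial in
lemma eval_cyclotomic_eight (a : ℤ) : (cyclotomic 8 ℤ).eval a = a ^ 4 + 1 := by
  have h4 := eval_cyclotomic_pow_of_dvd Nat.prime_two (show 2 ∣ 4 by norm_num) a
  have h2 := eval_cyclotomic_pow_of_dvd Nat.prime_two (show 2 ∣ 2 by norm_num) (a ^ 2)
  norm_num at h4 h2
  rw [← h4, ← h2]; ring

open Polynomial in
lemma eval_cyclotomic_nine (a : ℤ) : (cyclotomic 9 ℤ).eval a = a ^ 6 + a ^ 3 + 1 := by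
  have h := eval_cyclotomic_pow_of_dvd Nat.prime_three (show 3 ∣ 3 by norm_num) a
  norm_num [cyclotomic_three] at h
  rw [← h]; ring

open Polynomial in
lemma eval_cyclotomic_six (a : ℤ) : (cyclotomic 6 ℤ).eval a = a ^ 2 - a + 1 := by
  simp [cyclotomic_six]

open Polynomial in
lemma eval_cyclotomic_ten {a : ℤ} (ha : a + 1 ≠ 0) :
    (cyclotomic 10 ℤ).eval a = a ^ 4 - a ^ 3 + a ^ 2 - a + 1 := by
  have h := eval_cyclotomic_pow_of_not_dvd Nat.prime_five (show ¬ 5 ∣ 2 by norm_num) a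
  norm_num at h
  apply mul_right_cancel₀ ha
  rw [← h]; ring

open Polynomial in
lemma eval_cyclotomic_twelve (a : ℤ) : (cyclotomic 12 ℤ).eval a = a ^ 4 - a ^ 2 + 1 := by
  have h := eval_cyclotomic_pow_of_dvd Nat.prime_two (show 2 ∣ 6 by norm_num) a
  rw [eval_cyclotomic_six] at h
  norm_num at h
  rw [← h]; ring

open Polynomial in
lemma eval_cyclotomic_fourteen {a : ℤ} (ha : a + 1 ≠ 0) :
    (cyclotomic 14 ℤ).eval a = a ^ 6 - a ^ 5 + a ^ 4 - a ^ 3 + a ^ 2 - a + 1 := by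
  have h := eval_cyclotomic_pow_of_not_dvd Nat.prime_seven (show ¬ 7 ∣ 2 by norm_num) a
  norm_num at h
  apply mul_right_cancel₀ ha
  rw [← h]; ring

open Polynomial in
lemma eval_cyclotomic_eighteen (a : ℤ) : (cyclotomic 18 ℤ).eval a = a ^ 6 - a ^ 3 + 1 := by
  have h := eval_cyclotomic_pow_of_dvd Nat.prime_three (show 3 ∣ 6 by norm_num) a
  rw [eval_cyclotomic_six] at h
  norm_num at h
  rw [← h]; ring

open Polynomial in
lemma eval_cyclotomic_twenty {a : ℤ} :
    (cyclotomic 20 ℤ).eval a = a ^ 8 - a ^ 6 + a ^ 4 - a ^ 2 + 1 := by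
  have h := eval_cyclotomic_pow_of_dvd Nat.prime_two (show 2 ∣ 10 by norm_num) a
  rw [eval_cyclotomic_ten (by positivity)] at h
  norm_num at h
  rw [← h]; ring

open Polynomial in
lemma eval_cyclotomic_fifteen (a : ℤ) :
    (cyclotomic 15 ℤ).eval a = a ^ 8 - a ^ 7 + a ^ 5 - a ^ 4 + a ^ 3 - a + 1 := by
  have h := eval_cyclotomic_pow_of_not_dvd Nat.prime_five (show ¬ 5 ∣ 3 by norm_num) a
  norm_num [cyclotomic_three] at h
  apply mul_right_cancel₀ (by nlinarith [sq_nonneg (2 * a + 1)] : a ^ 2 + a + 1 ≠ 0)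
  rw [← h]; ring

open Polynomial in
lemma eval_cyclotomic_thirty (a : ℤ) :
    (cyclotomic 30 ℤ).eval a = a ^ 8 + a ^ 7 - a ^ 5 - a ^ 4 - a ^ 3 + a + 1 := by
  have h := eval_cyclotomic_pow_of_not_dvd Nat.prime_five (show ¬ 5 ∣ 6 by norm_num) a
  rw [eval_cyclotomic_six, eval_cyclotomic_six] at h
  norm_num at h
  apply mul_right_cancel₀ (by nlinarith [sq_nonneg (2 * a - 1)] : a ^ 2 - a + 1 ≠ 0)
  rw [← h]; ring

lemma four_mul_add_one_le_two_pow {m : ℕ} (hm : 10 ≤ m) : 4 * (m + 1) ≤ 2 ^ (m - 4) := by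
  induction m, hm using Nat.le_induction with
  | base => norm_num
  | succ m hm ih =>
    rw [show m + 1 - 4 = m - 4 + 1 by omega, pow_succ]
    omega

open Polynomial in
lemma mul_pow_four_le_cyclotomic_of_totient_eq_six {n c : ℕ} {a : ℤ}
    (hn : n ∈ ({7, 9, 14, 18} : Finset ℕ)) (ha : 2 ≤ a.natAbs) (ha5 : a.natAbs ≤ 5)
    (hc : c = 1 ∨ c.Prime ∧ c ∣ n ∧ (c : ℤ) ∣ (cyclotomic n ℤ).eval a) :
    c * a.natAbs ^ 4 ≤ ((cyclotomic n ℤ).eval a).natAbs := by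
  have ha1 : a + 1 ≠ 0 := by omega
  have hcn : c ∣ n := by
    obtain rfl | ⟨-, h, -⟩ := hc
    exacts [one_dvd _, h]
  have hc' : (c : ℤ) ∣ (cyclotomic n ℤ).eval a := by
    obtain rfl | ⟨-, -, h⟩ := hc
    exacts [by simp, h]
  have hcp : c = 1 ∨ c.Prime := hc.imp_right And.left
  clear hc
  have hlo : -5 ≤ a := by omega
  have hhi : a ≤ 5 := by omega
  have hcm : c ∈ n.divisors := Nat.mem_divisors.2 ⟨hcn, by rintro rfl; simp at hn⟩
  simp only [Finset.mem_insert, Finset.mem_singleton] at hn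
  obtain rfl | rfl | rfl | rfl := hn
  · rw [eval_cyclotomic_seven] at hc' ⊢
    rw [show Nat.divisors 7 = {1, 7} by decide] at hcm
    fin_cases hcm <;> interval_cases a <;> revert ha hc' hcp <;> decide
  · rw [eval_cyclotomic_nine] at hc' ⊢
    rw [show Nat.divisors 9 = {1, 3, 9} by decide] at hcm
    fin_cases hcm <;> interval_cases a <;> revert ha hc' hcp <;> decide
  · rw [eval_cyclotomic_fourteen ha1] at hc' ⊢
    rw [show Nat.divisors 14 = {1, 2, 7, 14} by decide] at hcm
    fin_cases hcm <;> interval_cases a <;> revert ha hc' hcp <;> decide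
  · rw [eval_cyclotomic_eighteen] at hc' ⊢
    rw [show Nat.divisors 18 = {1, 2, 3, 6, 9, 18} by decide] at hcm
    fin_cases hcm <;> interval_cases a <;> revert ha hc' hcp <;> decide

open Polynomial in
lemma mul_pow_four_le_cyclotomic_of_totient_eq_eight {n c : ℕ} {a : ℤ}
    (hn : n ∈ ({15, 16, 20, 24, 30} : Finset ℕ)) (htot : n.totient = 8) (ha : a.natAbs = 2)
    (hc : c = 1 ∨ c.Prime ∧ c ∣ n ∧ (c : ℤ) ∣ (cyclotomic n ℤ).eval a) :
    c * a.natAbs ^ 4 ≤ ((cyclotomic n ℤ).eval a).natAbs := by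
  have hn0 : n ≠ 0 := by rintro rfl; simp at htot
  have hN := pow_totient_le_four_mul_cyclotomic (n := n) (a := a) (by omega) ha.ge
  rw [htot, ha] at hN
  rw [ha]
  by_cases hc4 : c ≤ 4
  · omega
  obtain rfl | ⟨hcp, hcn, -⟩ := hc
  · omega
  have hcm : c ∈ n.primeFactors := Nat.mem_primeFactors.2 ⟨hcp, hcn, hn0⟩
  have hc5 : c ≤ 5 := by
    have h1 := Nat.totient_dvd_of_dvd hcn
    have h2 := Nat.le_of_dvd (by omega) hcn
    have h3 : n ≤ 30 := by
      simp only [Finset.mem_insert, Finset.mem_singleton] at hn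
      omega
    rw [htot, Nat.totient_prime hcp] at h1
    have h4 := Nat.le_of_dvd (by norm_num) h1
    have h5 : c ≤ 9 := by omega
    interval_cases c <;> revert hcp h1 <;> decide
  obtain rfl : c = 5 := by omega
  simp only [Finset.mem_insert, Finset.mem_singleton] at hn
  have ha' : a = 2 ∨ a = -2 := by omega
  obtain rfl | rfl | rfl | rfl | rfl := hn
  · rw [eval_cyclotomic_fifteen]; obtain rfl | rfl := ha' <;> norm_num
  · omega
  · rw [eval_cyclotomic_twenty]; obtain rfl | rfl := ha' <;> norm_num
  · omega
  · rw [eval_cyclotomic_thirty]; obtain rfl | rfl := ha' <;> norm_num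

lemma prime_le_totient_add_one {n c : ℕ} (hn : 0 < n) (hc : c = 1 ∨ c.Prime ∧ c ∣ n) :
    c ≤ n.totient + 1 := by
  obtain rfl | ⟨hp, hd⟩ := hc
  · omega
  have h := Nat.le_of_dvd (Nat.totient_pos.2 hn) (Nat.totient_dvd_of_dvd hd)
  rw [Nat.totient_prime hp] at h
  omega

open Polynomial in
lemma mul_pow_four_le_cyclotomic {n c : ℕ} {a : ℤ} (hn : 4 < n.totient) (ha : 2 ≤ a.natAbs)
    (hc : c = 1 ∨ c.Prime ∧ c ∣ n ∧ (c : ℤ) ∣ (cyclotomic n ℤ).eval a) :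
    c * a.natAbs ^ 4 ≤ ((cyclotomic n ℤ).eval a).natAbs := by
  have hn0 : 0 < n := by
    rcases Nat.eq_zero_or_pos n with rfl | h
    · simp at hn
    · exact h
  have hN := pow_totient_le_four_mul_cyclotomic hn0 ha
  have hcle := prime_le_totient_add_one hn0 (hc.imp_right fun h => ⟨h.1, h.2.1⟩)
  have of_le : 4 * (n.totient + 1) ≤ a.natAbs ^ (n.totient - 4) →
      c * a.natAbs ^ 4 ≤ ((cyclotomic n ℤ).eval a).natAbs := by
    intro h
    have h1 : 4 * c * a.natAbs ^ 4 ≤ a.natAbs ^ (n.totient - 4) * a.natAbs ^ 4 :=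
      Nat.mul_le_mul_right _ (by omega)
    rw [← pow_add, Nat.sub_add_cancel hn.le, mul_assoc] at h1
    omega
  obtain h10 | h10 := le_or_gt 10 n.totient
  · exact of_le ((four_mul_add_one_le_two_pow h10).trans (Nat.pow_le_pow_left ha _))
  obtain h | ⟨h6, h⟩ | ⟨h8, h⟩ := totient_small_cases hn0 (by omega) h10
  · exfalso
    revert hn
    fin_cases h <;> decide
  · obtain h5 | h5 := le_or_gt a.natAbs 5
    · exact mul_pow_four_le_cyclotomic_of_totient_eq_six h ha h5 hc
    · refine of_le ?_
      rw [h6]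
      exact le_trans (by norm_num) (Nat.pow_le_pow_left h5 _)
  · obtain h2 | h3 := ha.eq_or_lt
    · exact mul_pow_four_le_cyclotomic_of_totient_eq_eight h h8 h2.symm hc
    · refine of_le ?_
      rw [h8]
      exact le_trans (by norm_num) (Nat.pow_le_pow_left h3 _)

lemma pow_four_le_kPart {n : ℕ} {a : ℤ} (hn : 4 < n.totient) (ha : 2 ≤ a.natAbs) :
    a.natAbs ^ 4 ≤ kPart n a := by
  have hn3 : 3 ≤ n := by have := Nat.totient_le n; omega
  obtain ⟨c, hc, hdvd⟩ := exists_cyclotomic_dvd_mul_kPart hn3 ha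
  have hc0 : 0 < c := by
    obtain rfl | ⟨hp, -⟩ := hc
    exacts [one_pos, hp.pos]
  exact Nat.le_of_mul_le_mul_left ((mul_pow_four_le_cyclotomic hn ha hc).trans
    (Nat.le_of_dvd (Nat.mul_pos hc0 (kPart_pos n a)) hdvd)) hc0

open Polynomial in
lemma exists_cyclotomic_le_mul_kPart {n : ℕ} {a : ℤ} (hn : 3 ≤ n) (ha : 2 ≤ a.natAbs) :
    ∃ c : ℕ, (c = 1 ∨ c ∈ n.primeFactors ∧ (c : ℤ) ∣ (cyclotomic n ℤ).eval a) ∧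
      (cyclotomic n ℤ).eval a ≤ c * kPart n a := by
  obtain ⟨c, hc, hdvd⟩ := exists_cyclotomic_dvd_mul_kPart hn ha
  have hc0 : 0 < c := by
    obtain rfl | ⟨hp, -⟩ := hc
    exacts [one_pos, hp.pos]
  refine ⟨c, hc.imp_right fun h => ⟨Nat.mem_primeFactors.2 ⟨h.1, h.2.1, by omega⟩, h.2.2⟩, ?_⟩
  have := Nat.le_of_dvd (Nat.mul_pos hc0 (kPart_pos n a)) hdvd
  exact Int.le_natAbs.trans (by exact_mod_cast this)

lemma kPart_five_bound {a : ℤ} (ha : 2 ≤ a.natAbs) : ∃ c : ℕ, (c = 1 ∨ c = 5 ∧ a % 5 = 1) ∧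
    a ^ 4 + a ^ 3 + a ^ 2 + a + 1 ≤ c * kPart 5 a := by
  obtain ⟨c, hc, hle⟩ := exists_cyclotomic_le_mul_kPart (n := 5) (by norm_num) ha
  rw [eval_cyclotomic_five] at hc hle
  refine ⟨c, hc.imp_right fun ⟨h5, hd⟩ => ?_, hle⟩
  rw [Nat.prime_five.primeFactors, Finset.mem_singleton] at h5
  subst h5
  refine ⟨rfl, ?_⟩
  have hm := Int.emod_eq_zero_of_dvd hd
  have : a % 5 = 0 ∨ a % 5 = 1 ∨ a % 5 = 2 ∨ a % 5 = 3 ∨ a % 5 = 4 := by omega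
  rcases this with h | h | h | h | h <;> simp [Int.add_emod, pow_succ, Int.mul_emod, h] at hm ⊢

lemma kPart_ten_bound {a : ℤ} (ha : 2 ≤ a.natAbs) : ∃ c : ℕ, (c = 1 ∨ c = 5 ∧ a % 5 = 4) ∧
    a ^ 4 - a ^ 3 + a ^ 2 - a + 1 ≤ c * kPart 10 a := by
  obtain ⟨c, hc, hle⟩ := exists_cyclotomic_le_mul_kPart (n := 10) (by norm_num) ha
  rw [eval_cyclotomic_ten (by omega)] at hc hle
  refine ⟨c, hc.imp_right fun ⟨h5, hd⟩ => ?_, hle⟩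
  rw [show Nat.primeFactors 10 = {2, 5} by
    rw [show 10 = 2 * 5 by norm_num, Nat.primeFactors_mul (by norm_num) (by norm_num),
      Nat.prime_two.primeFactors, Nat.prime_five.primeFactors]; rfl] at h5
  have hm := Int.emod_eq_zero_of_dvd hd
  simp only [Finset.mem_insert, Finset.mem_singleton] at h5
  obtain rfl | rfl := h5
  · rcases Int.emod_two_eq_zero_or_one a with h | h <;>
      simp [Int.add_emod, Int.sub_emod, pow_succ, Int.mul_emod, h] at hm
  · refine ⟨rfl, ?_⟩
    have : a % 5 = 0 ∨ a % 5 = 1 ∨ a % 5 = 2 ∨ a % 5 = 3 ∨ a % 5 = 4 := by omega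
    rcases this with h | h | h | h | h <;>
      simp [Int.add_emod, Int.sub_emod, pow_succ, Int.mul_emod, h] at hm ⊢

lemma kPart_eight_bound {a : ℤ} (ha : 2 ≤ a.natAbs) : ∃ c : ℕ, (c = 1 ∨ c = 2 ∧ a % 2 = 1) ∧
    a ^ 4 + 1 ≤ c * kPart 8 a := by
  obtain ⟨c, hc, hle⟩ := exists_cyclotomic_le_mul_kPart (n := 8) (by norm_num) ha
  rw [eval_cyclotomic_eight] at hc hle
  refine ⟨c, hc.imp_right fun ⟨h2, hd⟩ => ?_, hle⟩
  rw [show 8 = 2 ^ 3 by norm_num, Nat.primeFactors_prime_pow (by norm_num) Nat.prime_two,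
    Finset.mem_singleton] at h2
  subst h2
  refine ⟨rfl, ?_⟩
  have hm := Int.emod_eq_zero_of_dvd hd
  rcases Int.emod_two_eq_zero_or_one a with h | h <;>
    simp [Int.add_emod, pow_succ, Int.mul_emod, h] at hm ⊢

lemma kPart_twelve_bound {a : ℤ} (ha : 2 ≤ a.natAbs) : a ^ 4 - a ^ 2 + 1 ≤ kPart 12 a := by
  obtain ⟨c, hc, hle⟩ := exists_cyclotomic_le_mul_kPart (n := 12) (by norm_num) ha
  rw [eval_cyclotomic_twelve] at hc hle
  obtain rfl | ⟨h23, hd⟩ := hc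
  · simpa using hle
  exfalso
  rw [show Nat.primeFactors 12 = {2, 3} by
    rw [show 12 = 2 ^ 2 * 3 by norm_num, Nat.primeFactors_mul (by norm_num) (by norm_num),
      Nat.primeFactors_prime_pow (by norm_num) Nat.prime_two, Nat.prime_three.primeFactors];
    rfl] at h23
  have hm := Int.emod_eq_zero_of_dvd hd
  simp only [Finset.mem_insert, Finset.mem_singleton] at h23
  obtain rfl | rfl := h23
  · rcases Int.emod_two_eq_zero_or_one a with h | h <;>
      simp [Int.add_emod, Int.sub_emod, pow_succ, Int.mul_emod, h] at hm
  · have : a % 3 = 0 ∨ a % 3 = 1 ∨ a % 3 = 2 := by omega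
    rcases this with h | h | h <;>
      simp [Int.add_emod, Int.sub_emod, pow_succ, Int.mul_emod, h] at hm

/-- The capped ratio `min(1, k_n(a) / a⁴)`. -/
noncomputable def kRatio (n : ℕ) (a : ℤ) : ℚ := min 1 (kPart n a / (a : ℚ) ^ 4)

lemma le_kRatio {n c : ℕ} {a : ℤ} (ha : a ≠ 0) (hc : 0 < c) {y : ℚ} (hy : y ≤ (a : ℚ) ^ 4)
    (h : y ≤ c * kPart n a) : y / (c * (a : ℚ) ^ 4) ≤ kRatio n a := by
  have ha4 : (0 : ℚ) < (a : ℚ) ^ 4 := by positivity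
  have hc1 : (1 : ℚ) ≤ c := by exact_mod_cast hc
  refine le_min ?_ ?_
  · rw [div_le_one (by positivity)]
    nlinarith
  · rw [← div_div]
    gcongr
    rwa [div_le_iff₀' (by positivity)]

lemma kRatio_le_one (n : ℕ) (a : ℤ) : kRatio n a ≤ 1 := min_le_left _ _

lemma kRatio_nonneg (n : ℕ) (a : ℤ) : 0 ≤ kRatio n a := le_min zero_le_one (by positivity)

lemma kRatio_five_mul_kRatio_ten_bound {q : ℕ} (hq : 2 ≤ q) {a : ℤ} (ha : a = q ∨ a = -q) :
    ∃ d : ℕ, (d = 1 ∨ d = 5 ∧ (q % 5 = 1 ∨ q % 5 = 4)) ∧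
      ((q : ℚ) ^ 4 - q ^ 3 + q ^ 2 - q + 1) / (d * (q : ℚ) ^ 4) ≤ kRatio 5 a * kRatio 10 a := by
  have ha2 : 2 ≤ a.natAbs := by omega
  have ha0 : a ≠ 0 := by omega
  have hq2 : (2 : ℚ) ≤ q := by exact_mod_cast hq
  have ha4 : (a : ℚ) ^ 4 = q ^ 4 := by obtain rfl | rfl := ha <;> simp [Even.neg_pow ⟨2, rfl⟩]
  have hB : (q : ℚ) ^ 4 - q ^ 3 + q ^ 2 - q + 1 ≤ q ^ 4 := by nlinarith [sq_nonneg (q : ℚ)]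
  obtain ⟨c, hc, hle⟩ := kPart_five_bound ha2
  obtain ⟨c', hc', hle'⟩ := kPart_ten_bound ha2
  have hc0 : 0 < c := by omega
  have hc0' : 0 < c' := by omega
  refine ⟨c * c', ?_, ?_⟩
  · obtain rfl | ⟨rfl, h⟩ := hc <;> obtain rfl | ⟨rfl, h'⟩ := hc' <;> omega
  have hleQ : ((a : ℚ) ^ 4 + a ^ 3 + a ^ 2 + a + 1) ≤ c * kPart 5 a := by exact_mod_cast hle
  have hleQ' : ((a : ℚ) ^ 4 - a ^ 3 + a ^ 2 - a + 1) ≤ c' * kPart 10 a := by exact_mod_cast hle'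
  have hq0 : (q : ℚ) ≠ 0 := by positivity
  have hBnn : (0 : ℚ) ≤ (q : ℚ) ^ 4 - q ^ 3 + q ^ 2 - q + 1 := by
    nlinarith [mul_nonneg (by linarith : (0 : ℚ) ≤ q - 1) (by positivity : (0 : ℚ) ≤ (q : ℚ) ^ 3),
      mul_nonneg (by linarith : (0 : ℚ) ≤ q - 1) (by positivity : (0 : ℚ) ≤ (q : ℚ))]
  obtain rfl | rfl := ha
  · simp only [Int.cast_natCast] at hleQ hleQ' ha4
    have h1 := le_kRatio (n := 5) ha0 hc0 (y := (q : ℚ) ^ 4) (by simp)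
      (le_trans (by nlinarith [pow_pos (by linarith : (0 : ℚ) < q) 3, sq_nonneg (q : ℚ)]) hleQ)
    have h2 := le_kRatio (n := 10) ha0 hc0' (y := (q : ℚ) ^ 4 - q ^ 3 + q ^ 2 - q + 1)
      (by simpa using hB) hleQ'
    simp only [Int.cast_natCast] at h1 h2
    refine le_trans (le_of_eq ?_) (mul_le_mul h1 h2 (by positivity) (kRatio_nonneg _ _))
    push_cast
    field_simp
  · push_cast at hleQ hleQ'
    have h1 := le_kRatio (n := 5) ha0 hc0 (y := (q : ℚ) ^ 4 - q ^ 3 + q ^ 2 - q + 1)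
      (by rw [ha4]; exact hB) (le_trans (le_of_eq (by ring)) hleQ)
    have h2 := le_kRatio (n := 10) ha0 hc0' (y := (q : ℚ) ^ 4) ha4.ge
      (le_trans (by nlinarith [pow_pos (by linarith : (0 : ℚ) < q) 3, sq_nonneg (q : ℚ)]) hleQ')
    rw [ha4] at h1 h2
    refine le_trans (le_of_eq ?_) (mul_le_mul h1 h2 (by positivity) (kRatio_nonneg _ _))
    push_cast
    field_simp

lemma pow_eight_bound {q d c : ℕ} (hq : 2 ≤ q) (hd : d = 1 ∨ d = 5 ∧ (q % 5 = 1 ∨ q % 5 = 4))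
    (hc : c = 1 ∨ c = 2 ∧ q % 2 = 1) :
    (q : ℚ) ^ 8 / 12 + 1 / 2 ≤
      ((q : ℚ) ^ 4 - q ^ 3 + q ^ 2 - q + 1) / d * (1 / c) * (q ^ 4 - q ^ 2 + 1) := by
  obtain rfl | ⟨rfl, h5⟩ := hd <;> obtain rfl | ⟨rfl, h2⟩ := hc
  · obtain ⟨x, rfl⟩ := Nat.exists_eq_add_of_le hq
    rw [← sub_nonneg]
    push_cast
    ring_nf
    positivity
  · obtain ⟨x, rfl⟩ := Nat.exists_eq_add_of_le (by omega : 3 ≤ q)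
    rw [← sub_nonneg]
    push_cast
    ring_nf
    positivity
  · obtain ⟨x, rfl⟩ := Nat.exists_eq_add_of_le (by omega : 4 ≤ q)
    rw [← sub_nonneg]
    push_cast
    ring_nf
    positivity
  · obtain ⟨x, rfl⟩ := Nat.exists_eq_add_of_le (by omega : 9 ≤ q)
    rw [← sub_nonneg]
    push_cast
    ring_nf
    positivity

lemma prod_kRatio_bound {q : ℕ} (hq : 2 ≤ q) {a : ℤ} (ha : a = q ∨ a = -q) :
    (q : ℚ) ^ 8 / 12 + 1 / 2 ≤ (q : ℚ) ^ 8 * ∏ i ∈ ({5, 8, 10, 12} : Finset ℕ), kRatio i a := by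
  have ha2 : 2 ≤ a.natAbs := by omega
  have ha0 : a ≠ 0 := by omega
  have hq2 : (2 : ℚ) ≤ q := by exact_mod_cast hq
  have hq0 : (q : ℚ) ≠ 0 := by positivity
  have ha4 : (a : ℚ) ^ 4 = q ^ 4 := by obtain rfl | rfl := ha <;> simp [Even.neg_pow ⟨2, rfl⟩]
  have haa : (a : ℚ) ^ 2 = q ^ 2 := by obtain rfl | rfl := ha <;> simp
  obtain ⟨d, hd, hle⟩ := kRatio_five_mul_kRatio_ten_bound hq ha
  obtain ⟨c, hc, h8⟩ := kPart_eight_bound ha2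
  have h12 := kPart_twelve_bound ha2
  have hc0 : 0 < c := by omega
  have hd0 : 0 < d := by omega
  have hr8 := le_kRatio (n := 8) ha0 hc0 (y := (a : ℚ) ^ 4) le_rfl
    (by have : (a : ℚ) ^ 4 + 1 ≤ c * kPart 8 a := by exact_mod_cast h8
        linarith)
  have hr12 := le_kRatio (n := 12) ha0 one_pos (y := (a : ℚ) ^ 4 - a ^ 2 + 1)
    (by rw [haa]; nlinarith) (by rw [Nat.cast_one, one_mul]; exact_mod_cast h12)
  rw [ha4] at hr8
  rw [ha4, haa] at hr12
  have hprod : ∏ i ∈ ({5, 8, 10, 12} : Finset ℕ), kRatio i a =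
      kRatio 5 a * kRatio 10 a * kRatio 8 a * kRatio 12 a := by
    simp; ring
  have hD : (0 : ℚ) ≤ (q : ℚ) ^ 4 - q ^ 2 + 1 := by nlinarith [sq_nonneg ((q : ℚ) ^ 2 - 1)]
  calc (q : ℚ) ^ 8 / 12 + 1 / 2
      ≤ ((q : ℚ) ^ 4 - q ^ 3 + q ^ 2 - q + 1) / d * (1 / c) * (q ^ 4 - q ^ 2 + 1) :=
        pow_eight_bound hq hd (by omega)
    _ = (q : ℚ) ^ 8 * (((q : ℚ) ^ 4 - q ^ 3 + q ^ 2 - q + 1) / (d * (q : ℚ) ^ 4) *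
          ((q : ℚ) ^ 4 / (c * (q : ℚ) ^ 4)) *
          (((q : ℚ) ^ 4 - q ^ 2 + 1) / ((1 : ℕ) * (q : ℚ) ^ 4))) := by
        push_cast
        field_simp
    _ ≤ (q : ℚ) ^ 8 * (kRatio 5 a * kRatio 10 a * kRatio 8 a * kRatio 12 a) := by
        have h0 := kRatio_nonneg 5 a
        have h1 := kRatio_nonneg 10 a
        have h2 := kRatio_nonneg 8 a
        gcongr
    _ = _ := by rw [hprod]

lemma kRatio_eq_one {n : ℕ} {a : ℤ} (hn : 4 < n.totient) (ha : 2 ≤ a.natAbs) :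
    kRatio n a = 1 := by
  have ha0 : a ≠ 0 := by omega
  refine min_eq_left ((one_le_div (by positivity)).2 ?_)
  have h : ((a.natAbs ^ 4 : ℕ) : ℤ) ≤ kPart n a := by exact_mod_cast pow_four_le_kPart hn ha
  push_cast at h
  rw [Even.pow_abs ⟨2, rfl⟩] at h
  exact_mod_cast h

/-- If `I` is a finite set of positive integers with `|I| ≥ 2` and `φ(i) > 2` for all
`i ∈ I`, then `∏_{i ∈ I} k_i(εq) ≥ C·q^(4|I|) + 1/2`, where `C = 1/12` if `|I| = 2`
and `C = 1/24` if `|I| ≥ 3`. -/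
theorem kPart_prod_bound (q : ℕ) (hq : IsPrimePow q) (ε : ℤ) (hε : ε = 1 ∨ ε = -1)
    (I : Finset ℕ) (hpos : ∀ i ∈ I, 0 < i) (hcard : 2 ≤ I.card)
    (hphi : ∀ i ∈ I, 2 < Nat.totient i) :
    (if I.card = 2 then (1 : ℚ) / 12 else (1 : ℚ) / 24) * (q : ℚ) ^ (4 * I.card) + 1 / 2 ≤
      ∏ i ∈ I, (kPart i (ε * q) : ℚ) := by
  set a : ℤ := ε * q with ha_def
  have hq2 : 2 ≤ q := hq.two_le
  have ha : a = q ∨ a = -q := by rcases hε with rfl | rfl <;> simp [ha_def]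
  have ha2 : 2 ≤ a.natAbs := by omega
  have hqQ : (1 : ℚ) ≤ q := by exact_mod_cast hq2.trans' one_le_two
  have ha4 : (a : ℚ) ^ 4 = q ^ 4 := by
    rcases ha with h | h <;> rw [h] <;> simp [Even.neg_pow ⟨2, rfl⟩]
  have hsmall : ∏ i ∈ ({5, 8, 10, 12} : Finset ℕ), kRatio i a ≤ ∏ i ∈ I, kRatio i a := by
    calc ∏ i ∈ ({5, 8, 10, 12} : Finset ℕ), kRatio i a
        = ∏ i ∈ I ∪ {5, 8, 10, 12}, kRatio i a := by
          refine Finset.prod_subset Finset.subset_union_right fun i hi hni => ?_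
          have hiI : i ∈ I := (Finset.mem_union.1 hi).resolve_right hni
          refine kRatio_eq_one ?_ ha2
          by_contra hlt
          rcases totient_small_cases (hpos i hiI) (hphi i hiI) (by omega) with h | h | h
          · exact hni h
          · omega
          · omega
      _ ≤ _ := Finset.prod_le_prod_of_subset_of_le_one Finset.subset_union_left
          (fun i _ => kRatio_nonneg i a) fun i _ _ => kRatio_le_one i a
  have hprod : (q : ℚ) ^ (4 * I.card) * ∏ i ∈ I, kRatio i a ≤ ∏ i ∈ I, (kPart i a : ℚ) := by
    rw [pow_mul, ← Finset.prod_const, ← Finset.prod_mul_distrib]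
    refine Finset.prod_le_prod (fun i _ => mul_nonneg (by positivity) (kRatio_nonneg i a))
      fun i _ => ?_
    rw [mul_comm, ← le_div_iff₀ (by positivity), ← ha4]
    exact min_le_right _ _
  have hbound := prod_kRatio_bound hq2 ha
  obtain ⟨m, hm⟩ := Nat.exists_eq_add_of_le hcard
  have hpow : (q : ℚ) ^ (4 * I.card) = q ^ (4 * m) * q ^ 8 := by rw [hm]; ring
  have hone : (1 : ℚ) ≤ (q : ℚ) ^ (4 * m) := one_le_pow₀ hqQ
  have hC : (if I.card = 2 then (1 : ℚ) / 12 else (1 : ℚ) / 24) ≤ 1 / 12 := by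
    split_ifs <;> norm_num
  calc (if I.card = 2 then (1 : ℚ) / 12 else (1 : ℚ) / 24) * (q : ℚ) ^ (4 * I.card) + 1 / 2
      ≤ 1 / 12 * (q : ℚ) ^ (4 * I.card) + 1 / 2 := by gcongr
    _ ≤ (q : ℚ) ^ (4 * m) * ((q : ℚ) ^ 8 / 12 + 1 / 2) := by rw [hpow]; linarith
    _ ≤ (q : ℚ) ^ (4 * m) * ((q : ℚ) ^ 8 * ∏ i ∈ ({5, 8, 10, 12} : Finset ℕ), kRatio i a) := by
        gcongr
    _ = (q : ℚ) ^ (4 * I.card) * ∏ i ∈ ({5, 8, 10, 12} : Finset ℕ), kRatio i a := by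
        rw [hpow, mul_assoc]
    _ ≤ (q : ℚ) ^ (4 * I.card) * ∏ i ∈ I, kRatio i a := by gcongr
    _ ≤ _ := hprod
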